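/- A D-snake in 𝔇_n (n ≥ 2) is a signed permutation w ∈ 𝔇_n with −w_2 > w_1 > w_2 < w_3 > w_4 < ⋯, i.e. −w_2 > w_1, w_i > w_{i+1} for every odd i ∈ {1,…,n−1}, and w_i < w_{i+1} for every even i ∈ {2,…,n−1}; let S_n^D(q) = Σ_{w D-snake in 𝔇_n} q^{inv_D(w)}. Then in ℚ(q)[[u]]: (Σ_{n≥1} S_{2n}^D(q)·u^{2n}/D_{2n}(1,q)) · (−cos_q(u)) = −2·cos_q(u)·(cos_q(u) − 1) + cos_q(u)·(cos_D(u;q) − 1) − 2·sin_q(u)² + sin_q(u)·sin_D(u;q), and (Σ_{n≥1} S_{2n+1}^D(q)·u^{2n+1}/D_{2n+1}(1,q)) · (−cos_q(u)) = −2·sin_q(u) + u·cos_q(u) + sin_D(u;q). -/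

import Mathlib

open Finset

/-- The hyperoctahedral group `𝔅_n`, encoded as (permutation of positions, signs):
the signed permutation sends `i+1` to `±(σ i + 1)`. -/
abbrev BG (n : ℕ) := Equiv.Perm (Fin n) × (Fin n → Bool)

/-- The value `π_i` (for `1 ≤ i ≤ n`) of the signed permutation, with `π_0 = 0`. -/
def bval {n : ℕ} (w : BG n) (i : ℕ) : ℤ :=
  if h : 1 ≤ i ∧ i ≤ n then
    (if w.2 ⟨i - 1, by omega⟩ then -1 else 1) * (((w.1 ⟨i - 1, by omega⟩ : Fin n) : ℕ) + 1 : ℤ)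
  else 0

/-- `edes_B`: even `i ∈ {0,…,n−1}` with `π_i > π_{i+1}`. -/
def edesB {n : ℕ} (w : BG n) : ℕ :=
  ((range n).filter fun i => Even i ∧ bval w (i + 1) < bval w i).card

/-- `odes_B`: odd `i ∈ {0,…,n−1}` with `π_i > π_{i+1}`. -/
def odesB {n : ℕ} (w : BG n) : ℕ :=
  ((range n).filter fun i => Odd i ∧ bval w (i + 1) < bval w i).card

/-- `easc_B`: even `i ∈ {0,…,n−1}` with `π_i < π_{i+1}`. -/
def eascB {n : ℕ} (w : BG n) : ℕ :=
  ((range n).filter fun i => Even i ∧ bval w i < bval w (i + 1)).card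

/-- `oasc_B`: odd `i ∈ {0,…,n−1}` with `π_i < π_{i+1}`. -/
def oascB {n : ℕ} (w : BG n) : ℕ :=
  ((range n).filter fun i => Odd i ∧ bval w i < bval w (i + 1)).card

/-- type B inversion number -/
def invB {n : ℕ} (w : BG n) : ℕ :=
  ((Icc 1 n ×ˢ Icc 1 n).filter fun p => p.1 < p.2 ∧ bval w p.2 < bval w p.1).card
  + ((Icc 1 n ×ˢ Icc 1 n).filter fun p => p.1 < p.2 ∧ bval w p.2 < -bval w p.1).card
  + ((Icc 1 n).filter fun i => bval w i < 0).card

/-- `B_n(s,t,q)` -/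
noncomputable def Bpoly {A : Type*} [CommRing A] (n : ℕ) (s t q : A) : A :=
  ∑ w : BG n, s ^ edesB w * t ^ odesB w * q ^ invB w

/-- `B_n(1,q)` -/
noncomputable def BOne {A : Type*} [CommRing A] (n : ℕ) (q : A) : A :=
  ∑ w : BG n, q ^ invB w

/-- `[k]_q` -/
def qInt {A : Type*} [CommRing A] (k : ℕ) (q : A) : A := ∑ i ∈ range k, q ^ i

/-- `[k]_q!` -/
def qFact {A : Type*} [CommRing A] (k : ℕ) (q : A) : A := ∏ i ∈ range k, qInt (i + 1) q

/-- number of negative values `π_1,…,π_n` -/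
def negs {n : ℕ} (w : BG n) : ℕ := ((Icc 1 n).filter fun i => bval w i < 0).card

/-- the type D group `𝔇_n` inside `𝔅_n` -/
def DG (n : ℕ) : Finset (BG n) := univ.filter fun w => Even (negs w)

/-- `odes_D`: odd `i ∈ {−1,1,…,n−1}` with `π_i > π_{|i|+1}` (the index `i = −1`
contributes iff `−π_1 > π_2`). -/
def odesD {n : ℕ} (w : BG n) : ℕ :=
  ((Icc 1 (n - 1)).filter fun i => Odd i ∧ bval w (i + 1) < bval w i).card
  + (if bval w 2 < -bval w 1 then 1 else 0)

/-- `edes_D`: even `i ∈ {−1,1,…,n−1}` with `π_i > π_{i+1}`. -/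
def edesD {n : ℕ} (w : BG n) : ℕ :=
  ((Icc 1 (n - 1)).filter fun i => Even i ∧ bval w (i + 1) < bval w i).card

/-- type D inversion number -/
def invD {n : ℕ} (w : BG n) : ℕ :=
  ((Icc 1 n ×ˢ Icc 1 n).filter fun p => p.1 < p.2 ∧ bval w p.2 < bval w p.1).card
  + ((Icc 1 n ×ˢ Icc 1 n).filter fun p => p.1 < p.2 ∧ bval w p.2 < -bval w p.1).card

/-- `D_n(s,t,q)` -/
noncomputable def Dpoly {A : Type*} [CommRing A] (n : ℕ) (s t q : A) : A :=
  ∑ w ∈ DG n, s ^ edesD w * t ^ odesD w * q ^ invD w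

/-- `D_n(1,q)` -/
noncomputable def DOne {A : Type*} [CommRing A] (n : ℕ) (q : A) : A :=
  ∑ w ∈ DG n, q ^ invD w

noncomputable section

/-- the field `ℚ(q)` -/
abbrev Kq : Type := RatFunc ℚ

/-- the variable `q` -/
def qv : Kq := RatFunc.X

/-- the set of D-snakes `−w_2 > w_1 > w_2 < w_3 > w_4 < ⋯` in `𝔇_n` -/
def SnakeD (n : ℕ) : Finset (BG n) :=
  (DG n).filter fun w =>
    bval w 1 < -bval w 2 ∧
    ∀ i : ℕ, i < n → 1 ≤ i →
      (Odd i → bval w (i + 1) < bval w i) ∧ (Even i → bval w i < bval w (i + 1))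

/-- `S_n^D(q)` -/
def SD (n : ℕ) : Kq := ∑ w ∈ SnakeD n, qv ^ invD w

open PowerSeries

/-- `cos_q(u)` -/
def cosq : PowerSeries Kq := PowerSeries.mk fun j =>
  if Even j then (-1 : Kq) ^ (j / 2) * (qFact j qv)⁻¹ else 0

/-- `sin_q(u)` -/
def sinq : PowerSeries Kq := PowerSeries.mk fun j =>
  if Odd j then (-1 : Kq) ^ (j / 2) * (qFact j qv)⁻¹ else 0

/-- `cos_D(u;q)` -/
def cosD : PowerSeries Kq := PowerSeries.mk fun j =>
  if Even j then (-1 : Kq) ^ (j / 2) * (DOne j qv)⁻¹ else 0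

/-- `sin_D(u;q)` -/
def sinD : PowerSeries Kq := PowerSeries.mk fun j =>
  if Odd j then (-1 : Kq) ^ (j / 2) * (DOne j qv)⁻¹ else 0

/-! ### Words and signed permutations -/

/-- The window of a signed permutation, indexed by `Fin n`. -/
def sval {n : ℕ} (w : BG n) (i : Fin n) : ℤ :=
  (if w.2 i then -1 else 1) * (((w.1 i : Fin n) : ℕ) + 1 : ℤ)

/-- A word indexed by `Fin n`, read with indices `1, …, n` and extended by `0`. -/
def natExt {n : ℕ} (a : Fin n → ℤ) (i : ℕ) : ℤ :=
  if h : 1 ≤ i ∧ i ≤ n then a ⟨i - 1, by omega⟩ else 0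

/-- The right action of a signed permutation on words. -/
def signScale {n : ℕ} (c : Fin n → ℤ) (g : BG n) (i : Fin n) : ℤ :=
  (if g.2 i then -1 else 1) * c (g.1 i)

/-- Composition of signed permutations. -/
def sComp {n : ℕ} (w g : BG n) : BG n :=
  (w.1 * g.1, fun i => xor (w.2 (g.1 i)) (g.2 i))

/-- Type D inversions of a word. -/
def pairInv {n : ℕ} (a : Fin n → ℤ) : ℕ :=
  ∑ i, ∑ j, if i < j then
    (if a j < a i then 1 else 0) + (if a j < -a i then 1 else 0) else 0

/-- Type D inversions between two words. -/
def crossInv {m k : ℕ} (a : Fin m → ℤ) (b : Fin k → ℤ) : ℕ :=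
  ∑ i, ∑ j, ((if b j < a i then 1 else 0) + (if b j < -a i then 1 else 0))

/-- Ordinary inversions of a word. -/
def wordInv {α : Type*} [LT α] [DecidableLT α] {n : ℕ} (a : Fin n → α) : ℕ :=
  ∑ i, ∑ j, if i < j then (if a j < a i then 1 else 0) else 0

/-- Pairs of entries of a word with negative sum. -/
def negPairs {n : ℕ} (a : Fin n → ℤ) : ℕ :=
  ∑ i, ∑ j, if i < j then (if a j < -a i then 1 else 0) else 0

lemma bval_eq_natExt {n : ℕ} (w : BG n) : bval w = natExt (sval w) := by
  funext i
  simp [bval, natExt, sval]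

lemma natExt_succ {n : ℕ} (a : Fin n → ℤ) (i : Fin n) : natExt a (i + 1) = a i := by
  have := i.2
  simp [natExt]

lemma sum_Icc_one_eq_sum_fin {M : Type*} [AddCommMonoid M] (n : ℕ) (f : ℕ → M) :
    ∑ i ∈ Icc 1 n, f i = ∑ i : Fin n, f (i + 1) := by
  rw [← Finset.sum_range fun i => f (i + 1), Finset.range_eq_Ico, Finset.sum_Ico_add' f 0 n 1]
  rfl

lemma invD_eq_pairInv {n : ℕ} (w : BG n) : invD w = pairInv (sval w) := by
  simp only [invD, pairInv, card_filter, sum_product, sum_Icc_one_eq_sum_fin, bval_eq_natExt,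
    natExt_succ, ← sum_add_distrib]
  refine sum_congr rfl fun i _ => sum_congr rfl fun j _ => ?_
  by_cases h : i < j <;> simp [h, Fin.lt_def.symm]

lemma pairInv_eq_add {n : ℕ} (a : Fin n → ℤ) : pairInv a = wordInv a + negPairs a := by
  simp only [pairInv, wordInv, negPairs, ← sum_add_distrib]
  refine sum_congr rfl fun i _ => sum_congr rfl fun j _ => ?_
  split_ifs <;> rfl

lemma pairInv_add {m k : ℕ} (a : Fin (m + k) → ℤ) :
    pairInv a = pairInv (a ∘ Fin.castAdd k) + pairInv (a ∘ Fin.natAdd m)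
      + crossInv (a ∘ Fin.castAdd k) (a ∘ Fin.natAdd m) := by
  have h1 (i : Fin m) (j : Fin k) : Fin.castAdd k i < Fin.natAdd m j := by
    simp only [Fin.lt_def, Fin.val_castAdd, Fin.val_natAdd]; omega
  have h2 (i : Fin m) (j : Fin k) : ¬ Fin.natAdd m j < Fin.castAdd k i := by
    simp only [Fin.lt_def, Fin.val_castAdd, Fin.val_natAdd]; omega
  have h3 (i j : Fin m) : Fin.castAdd k i < Fin.castAdd k j ↔ i < j := Iff.rfl
  have h4 (i j : Fin k) : Fin.natAdd m i < Fin.natAdd m j ↔ i < j := by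
    rw [Fin.lt_def, Fin.lt_def, Fin.val_natAdd, Fin.val_natAdd, Nat.add_lt_add_iff_left]
  simp only [pairInv, crossInv, Fin.sum_univ_add, h1, h2, h3, h4, if_true, if_false,
    sum_const_zero, Function.comp_apply, sum_add_distrib]
  ring

lemma sval_eq_signScale {n : ℕ} (w : BG n) :
    sval w = signScale (fun i => ((i : ℕ) + 1 : ℤ)) w := rfl

lemma signScale_signScale {n : ℕ} (c : Fin n → ℤ) (w g : BG n) :
    signScale (signScale c w) g = signScale c (sComp w g) := by
  funext i
  simp only [signScale, sComp, Equiv.Perm.mul_apply]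
  by_cases h : w.2 (g.1 i) <;> by_cases h' : g.2 i <;> simp [h, h']

lemma sval_sComp {n : ℕ} (w g : BG n) : sval (sComp w g) = signScale (sval w) g := by
  rw [sval_eq_signScale, sval_eq_signScale, signScale_signScale]

lemma sComp_left_bijective {n : ℕ} (g : BG n) : Function.Bijective fun w : BG n => sComp w g := by
  refine Finite.injective_iff_bijective.1 fun w w' h => ?_
  simp only [sComp, Prod.mk.injEq, mul_left_inj] at h
  refine Prod.ext h.1 (funext fun i => ?_)
  have := congrFun h.2 (g.1.symm i)
  simpa using this

lemma sComp_right_bijective {n : ℕ} (w : BG n) : Function.Bijective fun g : BG n => sComp w g := by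
  refine Finite.injective_iff_bijective.1 fun g g' h => ?_
  simp only [sComp, Prod.mk.injEq, mul_right_inj] at h
  refine Prod.ext h.1 (funext fun i => ?_)
  have := congrFun h.2 i
  simpa [h.1] using this

lemma sval_ne_zero {n : ℕ} (w : BG n) (i : Fin n) : sval w i ≠ 0 := by
  simp only [sval]
  split_ifs <;> simp <;> omega

lemma abs_sval {n : ℕ} (w : BG n) (i : Fin n) : |sval w i| = ((w.1 i : ℕ) + 1 : ℤ) := by
  simp only [sval]
  split_ifs
  · rw [abs_mul]; simp; omega
  · rw [abs_mul]; simp; omega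

lemma abs_sval_injective {n : ℕ} (w : BG n) : Function.Injective fun i => |sval w i| := by
  intro i j h
  simp only [abs_sval] at h
  exact w.1.injective (Fin.ext (by omega))

lemma sval_injective {n : ℕ} (w : BG n) : Function.Injective (sval w) := fun i j h =>
  abs_sval_injective w (by simp only [h])

/-- Every word with distinct nonzero absolute values standardizes to a signed permutation. -/
lemma exists_eq_signScale {n : ℕ} (a : Fin n → ℤ) (ha : Function.Injective fun i => |a i|)
    (h0 : ∀ i, a i ≠ 0) :
    ∃ (c : Fin n → ℤ) (g : BG n), StrictMono c ∧ (∀ i, 0 < c i) ∧ a = signScale c g := by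
  refine ⟨fun i => |a (Tuple.sort (fun i => |a i|) i)|,
    ((Tuple.sort fun i => |a i|)⁻¹, fun i => decide (a i < 0)), ?_, ?_, ?_⟩
  · exact (Tuple.monotone_sort fun i => |a i|).strictMono_of_injective
      (ha.comp (Tuple.sort fun i => |a i|).injective)
  · exact fun i => abs_pos.2 (h0 _)
  · funext i
    have hi : Tuple.sort (fun i => |a i|) ((Tuple.sort fun i => |a i|)⁻¹ i) = i := by simp
    simp only [signScale, decide_eq_true_eq, hi]
    split_ifs with h
    · rw [abs_of_neg h]; ring
    · rw [abs_of_nonneg (not_lt.1 h)]; ring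

/-- Every injective word standardizes to a permutation. -/
lemma exists_eq_comp_perm {n : ℕ} (a : Fin n → ℤ) (ha : Function.Injective a) :
    ∃ (c : Fin n → ℤ) (v : Equiv.Perm (Fin n)), StrictMono c ∧ a = c ∘ v := by
  refine ⟨a ∘ Tuple.sort a, (Tuple.sort a)⁻¹, ?_, ?_⟩
  · exact (Tuple.monotone_sort a).strictMono_of_injective (ha.comp (Tuple.sort a).injective)
  · funext i
    simp

lemma signScale_lt_signScale {n : ℕ} {c : Fin n → ℤ} (hc : StrictMono c) (h0 : ∀ i, 0 < c i)
    (g : BG n) (i j : Fin n) : signScale c g i < signScale c g j ↔ sval g i < sval g j := by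
  have hi := h0 (g.1 i)
  have hj := h0 (g.1 j)
  have h1 := hc.lt_iff_lt (a := g.1 i) (b := g.1 j)
  have h2 := hc.lt_iff_lt (a := g.1 j) (b := g.1 i)
  rw [Fin.lt_def] at h1 h2
  simp only [signScale, sval]
  split_ifs <;> omega

lemma signScale_lt_neg_signScale {n : ℕ} {c : Fin n → ℤ} (hc : StrictMono c) (h0 : ∀ i, 0 < c i)
    (g : BG n) (i j : Fin n) : signScale c g i < -signScale c g j ↔ sval g i < -sval g j := by
  have hi := h0 (g.1 i)
  have hj := h0 (g.1 j)
  have h1 := hc.lt_iff_lt (a := g.1 i) (b := g.1 j)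
  have h2 := hc.lt_iff_lt (a := g.1 j) (b := g.1 i)
  rw [Fin.lt_def] at h1 h2
  simp only [signScale, sval]
  split_ifs <;> omega

lemma pairInv_signScale {n : ℕ} {c : Fin n → ℤ} (hc : StrictMono c) (h0 : ∀ i, 0 < c i)
    (g : BG n) : pairInv (signScale c g) = invD g := by
  simp only [invD_eq_pairInv, pairInv, signScale_lt_signScale hc h0,
    signScale_lt_neg_signScale hc h0]

lemma wordInv_comp_perm {n : ℕ} {c : Fin n → ℤ} (hc : StrictMono c) (v : Equiv.Perm (Fin n)) :
    wordInv (c ∘ v) = wordInv v := by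
  simp only [wordInv, Function.comp_apply, hc.lt_iff_lt]

lemma crossInv_signScale {m k : ℕ} (a : Fin m → ℤ) (b : Fin k → ℤ) (g : BG m) :
    crossInv (signScale a g) b = crossInv a b := by
  simp only [crossInv]
  rw [← Equiv.sum_comp g.1 fun i => ∑ j, ((if b j < a i then 1 else 0) +
    (if b j < -a i then 1 else 0))]
  refine sum_congr rfl fun i _ => sum_congr rfl fun j _ => ?_
  simp only [signScale]
  by_cases h : g.2 i
  · simp [h, add_comm]
  · simp [h]

lemma crossInv_comp_perm {m k : ℕ} (a : Fin m → ℤ) (b : Fin k → ℤ) (v : Equiv.Perm (Fin k)) :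
    crossInv a (b ∘ v) = crossInv a b := by
  simp only [crossInv]
  refine sum_congr rfl fun i _ => ?_
  exact Equiv.sum_comp v fun j => ((if b j < a i then 1 else 0) + (if b j < -a i then 1 else 0))

lemma two_mul_negPairs {n : ℕ} (a : Fin n → ℤ) :
    2 * negPairs a = ∑ i, ∑ j, if i ≠ j then (if a j < -a i then 1 else 0) else 0 := by
  have h : negPairs a = ∑ i, ∑ j, if j < i then (if a j < -a i then 1 else 0) else 0 := by
    rw [negPairs, sum_comm]
    refine sum_congr rfl fun i _ => sum_congr rfl fun j _ => ?_
    simp only [lt_neg (a := a i)]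
  rw [two_mul]
  nth_rewrite 2 [h]
  simp only [negPairs, ← sum_add_distrib]
  refine sum_congr rfl fun i _ => sum_congr rfl fun j _ => ?_
  rcases lt_trichotomy i j with h | h | h
  · simp [h, h.ne, h.not_gt]
  · simp [h]
  · simp [h, h.ne', h.not_gt]

lemma negPairs_comp_perm {n : ℕ} (a : Fin n → ℤ) (v : Equiv.Perm (Fin n)) :
    negPairs (a ∘ v) = negPairs a := by
  have h : 2 * negPairs (a ∘ v) = 2 * negPairs a := by
    rw [two_mul_negPairs, two_mul_negPairs]
    refine Eq.trans ?_ (Equiv.sum_comp v _)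
    refine sum_congr rfl fun i _ => ?_
    refine Eq.trans ?_ (Equiv.sum_comp v _)
    simp
  omega

/-! ### Extending from an initial or a final segment -/

/-- Extension of a signed permutation to a longer one by the identity. -/
def extLeft {m : ℕ} (k : ℕ) (g : BG m) : BG (m + k) :=
  (finSumFinEquiv.permCongr (Equiv.sumCongr g.1 (Equiv.refl (Fin k))),
    Fin.append g.2 fun _ => false)

/-- Extension of a permutation to a signed permutation fixing the first letters. -/
def extRight (m : ℕ) {k : ℕ} (v : Equiv.Perm (Fin k)) : BG (m + k) :=
  (finSumFinEquiv.permCongr (Equiv.sumCongr (Equiv.refl (Fin m)) v), fun _ => false)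

lemma signScale_extLeft_castAdd {m k : ℕ} (a : Fin (m + k) → ℤ) (g : BG m) :
    signScale a (extLeft k g) ∘ Fin.castAdd k = signScale (a ∘ Fin.castAdd k) g := by
  funext i
  simp [signScale, extLeft, Equiv.permCongr_apply]

lemma signScale_extLeft_natAdd {m k : ℕ} (a : Fin (m + k) → ℤ) (g : BG m) :
    signScale a (extLeft k g) ∘ Fin.natAdd m = a ∘ Fin.natAdd m := by
  funext i
  simp [signScale, extLeft, Equiv.permCongr_apply]

lemma signScale_extRight_castAdd {m k : ℕ} (a : Fin (m + k) → ℤ) (v : Equiv.Perm (Fin k)) :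
    signScale a (extRight m v) ∘ Fin.castAdd k = a ∘ Fin.castAdd k := by
  funext i
  simp [signScale, extRight, Equiv.permCongr_apply]

lemma signScale_extRight_natAdd {m k : ℕ} (a : Fin (m + k) → ℤ) (v : Equiv.Perm (Fin k)) :
    signScale a (extRight m v) ∘ Fin.natAdd m = (a ∘ Fin.natAdd m) ∘ v := by
  funext i
  simp [signScale, extRight, Equiv.permCongr_apply]

/-! ### Weighted sums over signed permutations -/

open Classical in
/-- The sum of `q ^ invD w` over the signed permutations with a given property. -/
def wsum {K : Type*} [Field K] {n : ℕ} (q : K) (p : BG n → Prop) : K :=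
  ∑ w, if p w then q ^ invD w else 0

lemma wsum_congr {K : Type*} [Field K] {n : ℕ} (q : K) {p p' : BG n → Prop}
    (h : ∀ w, p w ↔ p' w) : wsum q p = wsum q p' := by
  rw [funext fun w => propext (h w)]

lemma card_mul_wsum_initial {K : Type*} [Field K] {m k : ℕ} (q : K) (P : (Fin m → ℤ) → Prop)
    (hP : ∀ (c : Fin m → ℤ) (g : BG m), StrictMono c → (∀ i, 0 < c i) →
      (P (signScale c g) ↔ P (sval g))) :
    (Fintype.card (BG m) : K) * wsum q (fun w : BG (m + k) => P (sval w ∘ Fin.castAdd k)) =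
      (∑ w : BG (m + k), q ^ (pairInv (sval w ∘ Fin.natAdd m) +
        crossInv (sval w ∘ Fin.castAdd k) (sval w ∘ Fin.natAdd m))) *
      wsum q fun g : BG m => P (sval g) := by
  classical
  have key (w : BG (m + k)) :
      (∑ g : BG m, if P (sval (sComp w (extLeft k g)) ∘ Fin.castAdd k) then
        q ^ invD (sComp w (extLeft k g)) else 0) =
      q ^ (pairInv (sval w ∘ Fin.natAdd m) +
        crossInv (sval w ∘ Fin.castAdd k) (sval w ∘ Fin.natAdd m)) *
      wsum q fun g : BG m => P (sval g) := by
    obtain ⟨c, g₀, hc, h0, hw⟩ := exists_eq_signScale (sval w ∘ Fin.castAdd k)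
      ((abs_sval_injective w).comp (Fin.castAdd_injective m k)) fun i => sval_ne_zero w _
    rw [wsum, ← (sComp_right_bijective g₀).sum_comp (fun g => if P (sval g) then q ^ invD g else 0),
      mul_sum]
    refine sum_congr rfl fun g _ => ?_
    have h1 : sval (sComp w (extLeft k g)) ∘ Fin.castAdd k = signScale c (sComp g₀ g) := by
      rw [sval_sComp, signScale_extLeft_castAdd, hw, signScale_signScale]
    have h2 : invD (sComp w (extLeft k g)) = invD (sComp g₀ g) +
        (pairInv (sval w ∘ Fin.natAdd m) +
          crossInv (sval w ∘ Fin.castAdd k) (sval w ∘ Fin.natAdd m)) := by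
      rw [invD_eq_pairInv, pairInv_add, h1, pairInv_signScale hc h0, ← h1, sval_sComp,
        signScale_extLeft_castAdd, signScale_extLeft_natAdd, crossInv_signScale, add_assoc]
    rw [h1, h2, hP c _ hc h0, pow_add]
    split_ifs
    · ring
    · simp
  rw [sum_mul, ← sum_congr rfl fun w _ => key w, sum_comm, ← nsmul_eq_mul, ← Finset.card_univ,
    ← sum_const]
  exact sum_congr rfl fun g _ =>
    ((sComp_left_bijective (extLeft k g)).sum_comp
      fun w => if P (sval w ∘ Fin.castAdd k) then q ^ invD w else 0).symm

/-- The sum over signed permutations whose initial segment has a given pattern. -/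
lemma wsum_initial_mul {K : Type*} [Field K] [CharZero K] {m k : ℕ} (q : K)
    (P : (Fin m → ℤ) → Prop)
    (hP : ∀ (c : Fin m → ℤ) (g : BG m), StrictMono c → (∀ i, 0 < c i) →
      (P (signScale c g) ↔ P (sval g))) :
    wsum q (fun w : BG (m + k) => P (sval w ∘ Fin.castAdd k)) * wsum q (fun _ : BG m => True) =
      wsum q (fun _ : BG (m + k) => True) * wsum q fun g : BG m => P (sval g) := by
  have h1 := card_mul_wsum_initial (k := k) q P hP
  have h2 := card_mul_wsum_initial (k := k) q (fun _ : Fin m → ℤ => True) fun _ _ _ _ => Iff.rfl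
  have h0 : (Fintype.card (BG m) : K) ≠ 0 := Nat.cast_ne_zero.2 Fintype.card_ne_zero
  refine mul_left_cancel₀ h0 ?_
  linear_combination h1 * wsum q (fun _ : BG m => True) - h2 * wsum q fun g : BG m => P (sval g)

open Classical in
lemma card_mul_wsum_final {K : Type*} [Field K] {m k : ℕ} (q : K) (P : (Fin m → ℤ) → Prop)
    (Q : (Fin k → ℤ) → Prop) (Q' : Equiv.Perm (Fin k) → Prop)
    (hQ : ∀ (c : Fin k → ℤ) (v : Equiv.Perm (Fin k)), StrictMono c → (Q (c ∘ v) ↔ Q' v)) :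
    (Fintype.card (Equiv.Perm (Fin k)) : K) * wsum q (fun w : BG (m + k) =>
        P (sval w ∘ Fin.castAdd k) ∧ Q (sval w ∘ Fin.natAdd m)) =
      (∑ w : BG (m + k), if P (sval w ∘ Fin.castAdd k) then
        q ^ (pairInv (sval w ∘ Fin.castAdd k) + negPairs (sval w ∘ Fin.natAdd m) +
        crossInv (sval w ∘ Fin.castAdd k) (sval w ∘ Fin.natAdd m)) else 0) *
      ∑ v : Equiv.Perm (Fin k), if Q' v then q ^ wordInv v else 0 := by
  have key (w : BG (m + k)) :
      (∑ v : Equiv.Perm (Fin k), if P (sval (sComp w (extRight m v)) ∘ Fin.castAdd k) ∧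
          Q (sval (sComp w (extRight m v)) ∘ Fin.natAdd m) then
        q ^ invD (sComp w (extRight m v)) else 0) =
      (if P (sval w ∘ Fin.castAdd k) then
        q ^ (pairInv (sval w ∘ Fin.castAdd k) + negPairs (sval w ∘ Fin.natAdd m) +
        crossInv (sval w ∘ Fin.castAdd k) (sval w ∘ Fin.natAdd m)) else 0) *
      ∑ v : Equiv.Perm (Fin k), if Q' v then q ^ wordInv v else 0 := by
    obtain ⟨c, v₀, hc, hw⟩ := exists_eq_comp_perm (sval w ∘ Fin.natAdd m)
      ((sval_injective w).comp (Fin.natAdd_injective k m))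
    rw [← (Group.mulLeft_bijective v₀).sum_comp
      (fun v : Equiv.Perm (Fin k) => if Q' v then q ^ wordInv v else 0), mul_sum]
    refine sum_congr rfl fun v _ => ?_
    have h1 : sval (sComp w (extRight m v)) ∘ Fin.castAdd k = sval w ∘ Fin.castAdd k := by
      rw [sval_sComp, signScale_extRight_castAdd]
    have h2 : sval (sComp w (extRight m v)) ∘ Fin.natAdd m = (sval w ∘ Fin.natAdd m) ∘ v := by
      rw [sval_sComp, signScale_extRight_natAdd]
    have h3 : (sval w ∘ Fin.natAdd m) ∘ v = c ∘ ⇑(v₀ * v) := by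
      rw [hw, Function.comp_assoc, Equiv.Perm.coe_mul]
    have h4 : invD (sComp w (extRight m v)) = wordInv ⇑(v₀ * v) +
        (pairInv (sval w ∘ Fin.castAdd k) + negPairs (sval w ∘ Fin.natAdd m) +
          crossInv (sval w ∘ Fin.castAdd k) (sval w ∘ Fin.natAdd m)) := by
      rw [invD_eq_pairInv, pairInv_add, h1, h2, crossInv_comp_perm, pairInv_eq_add (_ ∘ ⇑v),
        negPairs_comp_perm, h3, wordInv_comp_perm hc]
      ring
    rw [h4, h1, h2, h3, hQ c _ hc, pow_add]
    by_cases hp : P (sval w ∘ Fin.castAdd k) <;> by_cases hq : Q' (v₀ * v) <;>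
      simp [hp, hq, mul_comm]
  rw [sum_mul, ← sum_congr rfl fun w _ => key w, sum_comm, ← nsmul_eq_mul, ← Finset.card_univ,
    ← sum_const]
  refine sum_congr rfl fun v _ => ?_
  refine (sum_congr rfl fun w _ => ?_).trans ((sComp_left_bijective (extRight m v)).sum_comp
      fun w => if P (sval w ∘ Fin.castAdd k) ∧ Q (sval w ∘ Fin.natAdd m) then
        q ^ invD w else 0).symm
  congr

lemma wordInv_eq_zero {n : ℕ} {a : Fin n → Fin n} (ha : StrictMono a) : wordInv a = 0 := by
  simp only [wordInv, sum_eq_zero_iff, mem_univ, forall_const]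
  intro i j
  split_ifs with h h'
  · exact absurd h' (ha h).not_gt
  · rfl
  · rfl

lemma strictMono_perm_iff {n : ℕ} (v : Equiv.Perm (Fin n)) : StrictMono v ↔ v = 1 := by
  refine ⟨fun h => ?_, fun h => by rw [h]; exact strictMono_id⟩
  have := Subsingleton.elim (h.orderIsoOfSurjective v v.surjective) (OrderIso.refl _)
  exact Equiv.ext fun i => DFunLike.congr_fun this i

/-- The permutation with first letter `x.1` whose remaining letters are in the relative order of
`x.2`. -/
def permCons {k : ℕ} (x : Fin (k + 1) × Equiv.Perm (Fin k)) : Equiv.Perm (Fin (k + 1)) :=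
  (finSuccEquiv' 0).trans ((Equiv.optionCongr x.2).trans (finSuccEquiv' x.1).symm)

lemma permCons_zero {k : ℕ} (x : Fin (k + 1) × Equiv.Perm (Fin k)) : permCons x 0 = x.1 := by
  simp [permCons]

lemma permCons_succ {k : ℕ} (x : Fin (k + 1) × Equiv.Perm (Fin k)) (i : Fin k) :
    permCons x i.succ = x.1.succAbove (x.2 i) := by
  simp [permCons, finSuccEquiv'_zero, finSuccEquiv_succ]

lemma permCons_bijective {k : ℕ} : Function.Bijective (permCons (k := k)) := by
  refine (Fintype.bijective_iff_injective_and_card _).2 ⟨fun x y h => ?_, ?_⟩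
  · have h0 : x.1 = y.1 := by rw [← permCons_zero x, ← permCons_zero y, h]
    refine Prod.ext h0 (Equiv.ext fun i => ?_)
    have h1 := permCons_succ x i
    rw [h, permCons_succ, h0] at h1
    exact (Fin.succAbove_right_injective h1).symm
  · simp [Fintype.card_perm, Nat.factorial_succ]

lemma wordInv_permCons {k : ℕ} (x : Fin (k + 1) × Equiv.Perm (Fin k)) :
    wordInv (permCons x) = x.1 + wordInv x.2 := by
  have h (j : Fin k) : x.1.succAbove j < x.1 ↔ (j : ℕ) < x.1 := by
    rw [Fin.succAbove_lt_iff_castSucc_lt, Fin.lt_def, Fin.val_castSucc]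
  simp only [wordInv, Fin.sum_univ_succ, permCons_zero, permCons_succ, if_false,
    Fin.succ_pos, if_true, Fin.not_lt_zero, zero_add, Fin.succ_lt_succ_iff,
    (Fin.strictMono_succAbove x.1).lt_iff_lt]
  congr 1
  rw [Equiv.sum_comp x.2 fun j => if x.1.succAbove j < x.1 then 1 else 0]
  simp only [h]
  rw [Fin.sum_univ_eq_sum_range fun j => if j < (x.1 : ℕ) then 1 else 0, ← card_filter]
  have : (range k).filter (fun j => j < (x.1 : ℕ)) = range x.1 := by
    ext j
    have := x.1.2
    simp only [mem_filter, mem_range]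
    omega
  rw [this, card_range]

lemma sum_pow_wordInv {K : Type*} [CommRing K] (k : ℕ) (q : K) :
    ∑ v : Equiv.Perm (Fin k), q ^ wordInv v = qFact k q := by
  induction k with
  | zero => simp [wordInv, qFact]
  | succ k ih =>
    rw [← permCons_bijective.sum_comp fun v => q ^ wordInv v, Fintype.sum_prod_type]
    simp only [wordInv_permCons, pow_add, ← mul_sum, ih, ← sum_mul]
    rw [Fin.sum_univ_eq_sum_range fun i => q ^ i, mul_comm, ← qInt]
    exact (prod_range_succ _ _).symm

/-- The sum over signed permutations whose final segment is increasing. -/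
lemma wsum_final_mul {K : Type*} [Field K] [CharZero K] {m k : ℕ} (q : K)
    (P : (Fin m → ℤ) → Prop) :
    wsum q (fun w : BG (m + k) =>
        P (sval w ∘ Fin.castAdd k) ∧ StrictMono (sval w ∘ Fin.natAdd m)) * qFact k q =
      wsum q fun w : BG (m + k) => P (sval w ∘ Fin.castAdd k) := by
  classical
  have h1 := card_mul_wsum_final (m := m) (k := k) q P StrictMono (fun v => v = 1)
    fun c v hc => by
      rw [← strictMono_perm_iff]
      simp only [StrictMono, Function.comp_apply, hc.lt_iff_lt]
  have h2 := card_mul_wsum_final (m := m) (k := k) q P (fun _ => True) (fun _ => True)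
    fun _ _ _ => Iff.rfl
  have h0 : (Fintype.card (Equiv.Perm (Fin k)) : K) ≠ 0 :=
    Nat.cast_ne_zero.2 Fintype.card_ne_zero
  simp only [if_true, and_true, sum_pow_wordInv] at h2
  rw [sum_eq_single (1 : Equiv.Perm (Fin k)), if_pos rfl,
    wordInv_eq_zero ((strictMono_perm_iff _).2 rfl), pow_zero, mul_one] at h1
  · refine mul_left_cancel₀ h0 ?_
    rw [h2, ← h1, mul_assoc]
  · exact fun v _ hv => if_neg hv
  · exact fun h => absurd (mem_univ _) h

/-! ### Sign changes -/

/-- The signed permutation changing only the sign of the first letter. -/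
def signFlip (n : ℕ) : BG (n + 1) := (1, fun i => decide (i = 0))

lemma sval_flip_position {n : ℕ} (w : BG (n + 1)) (i : Fin (n + 1)) :
    sval (sComp w (signFlip n)) i = if i = 0 then -sval w i else sval w i := by
  rw [sval_sComp]
  by_cases h : i = 0 <;> simp [signScale, signFlip, h]

lemma sval_flip_value {n : ℕ} (w : BG (n + 1)) (i : Fin (n + 1)) :
    sval (sComp (signFlip n) w) i = if w.1 i = 0 then -sval w i else sval w i := by
  by_cases h : w.1 i = 0 <;> by_cases h' : w.2 i <;> simp [sval, sComp, signFlip, h, h']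

lemma sval_flip_value_lt {n : ℕ} (w : BG (n + 1)) {i j : Fin (n + 1)} (hij : i ≠ j) :
    sval (sComp (signFlip n) w) i < sval (sComp (signFlip n) w) j ↔ sval w i < sval w j := by
  have h : (w.1 i : ℕ) ≠ w.1 j := fun h => hij (w.1.injective (Fin.ext h))
  simp only [sval_flip_value, ← Fin.val_eq_zero_iff]
  simp only [sval]
  split_ifs <;> omega

lemma sval_flip_value_lt_neg {n : ℕ} (w : BG (n + 1)) {i j : Fin (n + 1)} (hij : i ≠ j) :
    sval (sComp (signFlip n) w) i < -sval (sComp (signFlip n) w) j ↔ sval w i < -sval w j := by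
  have h : (w.1 i : ℕ) ≠ w.1 j := fun h => hij (w.1.injective (Fin.ext h))
  simp only [sval_flip_value, ← Fin.val_eq_zero_iff]
  simp only [sval]
  split_ifs <;> omega

lemma invD_flip_value {n : ℕ} (w : BG (n + 1)) : invD (sComp (signFlip n) w) = invD w := by
  simp only [invD_eq_pairInv, pairInv]
  refine sum_congr rfl fun i _ => sum_congr rfl fun j _ => ?_
  by_cases h : i < j
  · simp only [sval_flip_value_lt w h.ne', sval_flip_value_lt_neg w h.ne']
  · simp only [h, if_false]

lemma invD_flip_position {n : ℕ} (w : BG (n + 1)) : invD (sComp w (signFlip n)) = invD w := by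
  simp only [invD_eq_pairInv, pairInv]
  refine sum_congr rfl fun i _ => sum_congr rfl fun j _ => ?_
  by_cases h : i < j
  · have hj : j ≠ 0 := (Fin.pos_of_ne_zero (Fin.ne_zero_of_lt h)).ne'
    by_cases hi : i = 0
    · simp only [sval_flip_position, hi, hj, if_true, if_false, neg_neg, add_comm]
    · simp only [sval_flip_position, hi, hj, if_false]
  · simp only [h, if_false]

lemma neg_one_pow_negs {n : ℕ} (w : BG n) :
    (-1 : ℤ) ^ negs w = ∏ i, if sval w i < 0 then -1 else 1 := by
  rw [prod_ite, prod_const, prod_const_one, mul_one, negs, card_filter, card_filter,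
    sum_Icc_one_eq_sum_fin]
  simp only [bval_eq_natExt, natExt_succ]

lemma even_negs_flip_value {n : ℕ} (w : BG (n + 1)) :
    Even (negs (sComp (signFlip n) w)) ↔ ¬ Even (negs w) := by
  have h : (-1 : ℤ) ^ negs (sComp (signFlip n) w) = -(-1) ^ negs w := by
    have h1 : ∏ i, (if w.1 i = 0 then -1 else 1 : ℤ) = -1 := by
      rw [Equiv.prod_comp w.1 fun i => if i = 0 then (-1 : ℤ) else 1, prod_ite_eq' univ,
        if_pos (mem_univ _)]
    have h2 : (∏ i, if sval (sComp (signFlip n) w) i < 0 then -1 else 1 : ℤ) =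
        (∏ i, if sval w i < 0 then -1 else 1) * ∏ i, if w.1 i = 0 then -1 else 1 := by
      rw [← prod_mul_distrib]
      refine prod_congr rfl fun i _ => ?_
      have := sval_ne_zero w i
      rw [sval_flip_value]
      split_ifs <;> first | rfl | omega
    rw [neg_one_pow_negs, neg_one_pow_negs, h2, h1, mul_neg_one]
  rcases Nat.even_or_odd (negs w) with h' | h'
  · rw [h'.neg_one_pow] at h
    simp only [h', not_true, iff_false]
    intro h2
    rw [h2.neg_one_pow] at h
    omega
  · rw [h'.neg_one_pow, neg_neg] at h
    simp only [Nat.not_even_iff_odd, h', iff_true]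
    by_contra h2
    rw [(Nat.not_even_iff_odd.1 h2).neg_one_pow] at h
    omega

lemma wsum_flip_position {K : Type*} [Field K] {n : ℕ} (q : K) (p : BG (n + 1) → Prop) :
    wsum q (fun w => p (sComp w (signFlip n))) = wsum q p := by
  classical
  rw [wsum, wsum, ← (sComp_left_bijective (signFlip n)).sum_comp fun w =>
    if p w then q ^ invD w else 0]
  simp only [invD_flip_position]

/-- Restricting a sum to the even-signed permutations halves it, when the summation condition is
insensitive to the sign of the value `±1`. -/
lemma two_mul_sum_DG {K : Type*} [Field K] {n : ℕ} (q : K) (p : BG (n + 1) → Prop)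
    [DecidablePred p] (hp : ∀ w, p (sComp (signFlip n) w) ↔ p w) :
    2 * ∑ w ∈ (DG (n + 1)).filter p, q ^ invD w = wsum q p := by
  classical
  have h1 : wsum q p = (∑ w : BG (n + 1), if Even (negs w) ∧ p w then q ^ invD w else 0) +
      ∑ w : BG (n + 1), if ¬ Even (negs w) ∧ p w then q ^ invD w else 0 := by
    rw [wsum, ← sum_add_distrib]
    refine sum_congr rfl fun w _ => ?_
    by_cases h : Even (negs w) <;> by_cases h' : p w <;> simp only [h, h', and_true,
      and_false, not_true, not_false_iff, if_true, if_false, add_zero, zero_add]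
  have h2 : (∑ w : BG (n + 1), if ¬ Even (negs w) ∧ p w then q ^ invD w else 0) =
      ∑ w : BG (n + 1), if Even (negs w) ∧ p w then q ^ invD w else 0 := by
    rw [← (sComp_right_bijective (signFlip n)).sum_comp]
    simp only [even_negs_flip_value, invD_flip_value, hp, not_not]
  rw [h1, h2, DG, filter_filter, sum_filter, two_mul]

/-! ### Descent patterns -/

/-- The first `m` letters of a word form a type D snake. -/
def IsSnake (a : ℕ → ℤ) (m : ℕ) : Prop :=
  a 1 < -a 2 ∧ ∀ i : ℕ, i < m → 1 ≤ i →
    (Odd i → a (i + 1) < a i) ∧ (Even i → a i < a (i + 1))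

/-- The letters of a word with indices from `m` to `n` are increasing. -/
def IncFrom (a : ℕ → ℤ) (m n : ℕ) : Prop := ∀ i, m ≤ i → i < n → a i < a (i + 1)

lemma IncFrom.lt {a : ℕ → ℤ} {m n : ℕ} (h : IncFrom a m n) {i j : ℕ} (hi : m ≤ i) (hij : i < j)
    (hj : j ≤ n) : a i < a j := by
  induction j, hij using Nat.le_induction with
  | base => exact h i hi hj
  | succ j hij ih => exact (ih (by omega)).trans (h j (by omega) hj)

lemma incFrom_iff_strictMono {m k : ℕ} (w : BG (m + k)) :
    IncFrom (bval w) (m + 1) (m + k) ↔ StrictMono (sval w ∘ Fin.natAdd m) := by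
  have hb (i : Fin k) : bval w (m + i + 1) = sval w (Fin.natAdd m i) := by
    rw [bval_eq_natExt, ← natExt_succ (sval w), Fin.val_natAdd]
  constructor
  · intro h i j hij
    rw [Function.comp_apply, Function.comp_apply, ← hb, ← hb]
    exact h.lt (by omega) (by rw [Fin.lt_def] at hij; omega) (by omega)
  · intro h i h1 h2
    have := h (show (⟨i - m - 1, by omega⟩ : Fin k) < ⟨i - m, by omega⟩ by
      rw [Fin.mk_lt_mk]; omega)
    rw [Function.comp_apply, Function.comp_apply, ← hb, ← hb] at this
    have e1 : m + (i - m - 1) + 1 = i := by omega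
    have e2 : m + (i - m) + 1 = i + 1 := by omega
    simpa only [e1, e2] using this

lemma isSnake_congr {a b : ℕ → ℤ} {m : ℕ} (hm : 2 ≤ m)
    (h : ∀ i j, i ≠ j → 1 ≤ i → i ≤ m → 1 ≤ j → j ≤ m →
      ((a i < a j ↔ b i < b j) ∧ (a i < -a j ↔ b i < -b j))) :
    IsSnake a m ↔ IsSnake b m := by
  refine and_congr (h 1 2 (by omega) (by omega) (by omega) (by omega) hm).2 ?_
  refine forall_congr' fun i => forall_congr' fun h1 => forall_congr' fun h2 => ?_
  rw [(h (i + 1) i (by omega) (by omega) (by omega) (by omega) (by omega)).1,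
    (h i (i + 1) (by omega) (by omega) (by omega) (by omega) (by omega)).1]

lemma natExt_eq {n : ℕ} (a : Fin n → ℤ) {i : ℕ} (h1 : 1 ≤ i) (h2 : i ≤ n) :
    natExt a i = a ⟨i - 1, by omega⟩ := dif_pos ⟨h1, h2⟩

lemma isSnake_castAdd {m k : ℕ} (hm : 2 ≤ m) (w : BG (m + k)) :
    IsSnake (natExt (sval w ∘ Fin.castAdd k)) m ↔ IsSnake (bval w) m := by
  have (i : ℕ) (h1 : 1 ≤ i) (h2 : i ≤ m) :
      natExt (sval w ∘ Fin.castAdd k) i = bval w i := by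
    rw [bval_eq_natExt, natExt_eq _ h1 h2, natExt_eq _ h1 (by omega)]
    rfl
  refine isSnake_congr hm fun i j _ h1 h2 h3 h4 => ?_
  rw [this i h1 h2, this j h3 h4]
  exact ⟨Iff.rfl, Iff.rfl⟩

lemma isSnake_signScale {m : ℕ} (hm : 2 ≤ m) (c : Fin m → ℤ) (g : BG m) (hc : StrictMono c)
    (h0 : ∀ i, 0 < c i) : IsSnake (natExt (signScale c g)) m ↔ IsSnake (natExt (sval g)) m := by
  refine isSnake_congr hm fun i j _ h1 h2 h3 h4 => ?_
  rw [natExt_eq _ h1 h2, natExt_eq _ h3 h4, natExt_eq _ h1 h2, natExt_eq _ h3 h4]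
  exact ⟨signScale_lt_signScale hc h0 g _ _, signScale_lt_neg_signScale hc h0 g _ _⟩

lemma isSnake_flip_value {n : ℕ} (w : BG (n + 2)) :
    IsSnake (bval (sComp (signFlip (n + 1)) w)) (n + 2) ↔ IsSnake (bval w) (n + 2) := by
  refine isSnake_congr (by omega) fun i j hij h1 h2 h3 h4 => ?_
  rw [bval_eq_natExt, bval_eq_natExt, natExt_eq _ h1 h2, natExt_eq _ h3 h4, natExt_eq _ h1 h2,
    natExt_eq _ h3 h4]
  have : (⟨i - 1, by omega⟩ : Fin (n + 2)) ≠ ⟨j - 1, by omega⟩ := by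
    rw [Ne, Fin.mk.injEq]; omega
  exact ⟨sval_flip_value_lt w this, sval_flip_value_lt_neg w this⟩

lemma bval_ne {n : ℕ} (w : BG n) {i j : ℕ} (hi : 1 ≤ i) (hi' : i ≤ n) (hj : 1 ≤ j) (hj' : j ≤ n)
    (hij : i ≠ j) : bval w i ≠ bval w j ∧ bval w i ≠ -bval w j := by
  rw [bval_eq_natExt, natExt_eq _ hi hi', natExt_eq _ hj hj']
  have : |sval w ⟨i - 1, by omega⟩| ≠ |sval w ⟨j - 1, by omega⟩| := fun h => by
    have := abs_sval_injective w h
    rw [Fin.mk.injEq] at this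
    omega
  exact ⟨fun h => this (by rw [h]), fun h => this (by rw [h, abs_neg])⟩

lemma bval_flip_position {n : ℕ} (w : BG (n + 1)) (i : ℕ) :
    bval (sComp w (signFlip n)) i = if i = 1 then -bval w i else bval w i := by
  by_cases h : 1 ≤ i ∧ i ≤ n + 1
  · rw [bval_eq_natExt, bval_eq_natExt, natExt_eq _ h.1 h.2, natExt_eq _ h.1 h.2,
      sval_flip_position]
    refine if_congr ?_ rfl rfl
    rw [← Fin.val_eq_zero_iff]
    dsimp only
    omega
  · have h1 : i ≠ 1 := by omega
    simp only [bval, dif_neg h, h1, if_false]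

/-! ### Recursions for snakes followed by an increasing run -/

/-- The sum over the signed permutations `w` with `|w₁| < w₂ < ⋯` is `2`. -/
lemma wsum_min {K : Type*} [Field K] {n : ℕ} (q : K) :
    wsum q (fun w : BG (n + 2) => IncFrom (bval w) 1 (n + 2) ∧ -bval w 1 < bval w 2) = 2 := by
  classical
  have hfirst (w : BG (n + 2)) : bval w 1 = sval w 0 := by
    rw [bval_eq_natExt, natExt_eq _ le_rfl (by omega)]; rfl
  have hsecond (w : BG (n + 2)) : bval w 2 = sval w 1 := by
    rw [bval_eq_natExt, natExt_eq _ (by omega) (by omega)]; rfl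
  have hlt {w : BG (n + 2)} (h : IncFrom (bval w) 1 (n + 2) ∧ -bval w 1 < bval w 2)
      {i j : Fin (n + 2)} (hij : i < j) : sval w i < sval w j ∧ -sval w i < sval w j := by
    have hmono : StrictMono (sval w) := by
      intro i j hij
      rw [← natExt_succ (sval w) i, ← natExt_succ (sval w) j, ← bval_eq_natExt]
      exact h.1.lt (by omega) (by rw [Fin.lt_def] at hij; omega) (by omega)
    have h1 : sval w 0 < sval w 1 := hmono (by simp)
    have h2 : -sval w 0 < sval w 1 := by rw [← hfirst, ← hsecond]; exact h.2
    have h3 : sval w 1 ≤ sval w j := hmono.monotone (by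
      rw [Fin.le_def, Fin.val_one]; rw [Fin.lt_def] at hij; omega)
    have h4 : sval w 0 ≤ sval w i := hmono.monotone (Fin.zero_le _)
    exact ⟨hmono hij, by omega⟩
  have hinv {w : BG (n + 2)} (h : IncFrom (bval w) 1 (n + 2) ∧ -bval w 1 < bval w 2) :
      invD w = 0 := by
    simp only [invD_eq_pairInv, pairInv, sum_eq_zero_iff, mem_univ, forall_const]
    intro i j
    by_cases hij : i < j
    · have := hlt h hij
      rw [if_pos hij, if_neg (by omega), if_neg (by omega), add_zero]
    · rw [if_neg hij]
  have hiff (w : BG (n + 2)) : (IncFrom (bval w) 1 (n + 2) ∧ -bval w 1 < bval w 2) ↔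
      w ∈ ({(1, fun _ => false), signFlip (n + 1)} : Finset (BG (n + 2))) := by
    rw [mem_insert, mem_singleton]
    constructor
    · intro h
      have hσ : w.1 = 1 := by
        rw [← strictMono_perm_iff]
        intro i j hij
        obtain ⟨h1, h2⟩ := hlt h hij
        have h3 : |sval w i| < |sval w j| := (abs_lt.2 ⟨by omega, h1⟩).trans_le (le_abs_self _)
        rw [abs_sval, abs_sval] at h3
        rw [Fin.lt_def]
        omega
      have hε (i : Fin (n + 2)) (hi : i ≠ 0) : w.2 i = false := by
        by_contra hc
        have h1 := hlt h (Fin.pos_of_ne_zero hi)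
        have h2 : sval w i < 0 := by
          simp only [sval, Bool.not_eq_false] at hc ⊢
          rw [if_pos hc]
          omega
        omega
      by_cases h0 : w.2 0
      · refine Or.inr (Prod.ext hσ (funext fun i => ?_))
        by_cases hi : i = 0
        · simp [hi, h0, signFlip]
        · simp [hi, hε i hi, signFlip]
      · refine Or.inl (Prod.ext hσ (funext fun i => ?_))
        by_cases hi : i = 0
        · simp [hi, h0]
        · simp [hε i hi]
    · have hone (i : Fin (n + 2)) : sval ((1, fun _ => false) : BG (n + 2)) i = i + 1 := by
        simp [sval]
      have hflip (i : Fin (n + 2)) : sval (signFlip (n + 1)) i =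
          if i = 0 then -(i + 1 : ℤ) else i + 1 := by
        by_cases hi : i = 0 <;> simp [sval, signFlip, hi]
      rintro (rfl | rfl)
      · refine ⟨fun i h1 h2 => ?_, ?_⟩
        · rw [bval_eq_natExt, natExt_eq _ h1 (by omega), natExt_eq _ (by omega) h2, hone, hone]
          push_cast
          omega
        · rw [hfirst, hsecond, hone, hone]
          simp
      · refine ⟨fun i h1 h2 => ?_, ?_⟩
        · rw [bval_eq_natExt, natExt_eq _ h1 (by omega), natExt_eq _ (by omega) h2, hflip, hflip]
          simp only [← Fin.val_eq_zero_iff]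
          split_ifs <;> omega
        · rw [hfirst, hsecond, hflip, hflip]
          simp
  have hne : ((1, fun _ => false) : BG (n + 2)) ≠ signFlip (n + 1) := fun h => by
    have := congrFun (congrArg Prod.snd h) 0
    simp [signFlip] at this
  have hcongr : wsum q (fun w : BG (n + 2) => IncFrom (bval w) 1 (n + 2) ∧ -bval w 1 < bval w 2) =
      ∑ w : BG (n + 2), if w ∈ ({(1, fun _ => false), signFlip (n + 1)} : Finset (BG (n + 2)))
        then 1 else 0 := by
    rw [wsum]
    refine sum_congr rfl fun w _ => ?_
    by_cases h : IncFrom (bval w) 1 (n + 2) ∧ -bval w 1 < bval w 2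
    · rw [if_pos h, if_pos ((hiff w).1 h), hinv h, pow_zero]
    · rw [if_neg h, if_neg fun h' => h ((hiff w).2 h')]
  rw [hcongr, sum_ite_mem, univ_inter, sum_const, card_pair hne, nsmul_eq_mul, mul_one,
    Nat.cast_two]

lemma wsum_inc_mul {K : Type*} [Field K] [CharZero K] (q : K) {n m k : ℕ} (h : n = m + k) :
    wsum q (fun w : BG n => IncFrom (bval w) (m + 1) n) * qFact k q =
      wsum q fun _ : BG n => True := by
  subst h
  rw [← wsum_final_mul q fun _ : Fin m → ℤ => True]
  congr 1
  exact wsum_congr q fun w => by rw [incFrom_iff_strictMono, true_and]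

lemma wsum_snake_inc_mul {K : Type*} [Field K] [CharZero K] (q : K) {n m k : ℕ} (h : n = m + k)
    (hm : 2 ≤ m) :
    wsum q (fun w : BG n => IsSnake (bval w) m ∧ IncFrom (bval w) (m + 1) n) * qFact k q *
      wsum q (fun _ : BG m => True) =
    wsum q (fun _ : BG n => True) * wsum q fun g : BG m => IsSnake (bval g) m := by
  subst h
  have h1 := wsum_final_mul (k := k) q fun a : Fin m → ℤ => IsSnake (natExt a) m
  have h2 := wsum_initial_mul (k := k) q (fun a : Fin m → ℤ => IsSnake (natExt a) m)
    (isSnake_signScale hm)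
  simp only [isSnake_castAdd hm, ← incFrom_iff_strictMono, ← bval_eq_natExt] at h1 h2
  rw [h1, h2]

lemma wsum_snake_two {K : Type*} [Field K] (q : K) (n : ℕ) :
    wsum q (fun w : BG (n + 2) => IsSnake (bval w) 2 ∧ IncFrom (bval w) 2 (n + 2)) =
      wsum q (fun w : BG (n + 2) => IncFrom (bval w) 2 (n + 2)) -
        2 * wsum q (fun w : BG (n + 2) => IncFrom (bval w) 1 (n + 2)) + 2 := by
  classical
  have hflip := wsum_flip_position q fun w : BG (n + 2) => IncFrom (bval w) 1 (n + 2)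
  rw [two_mul]
  nth_rewrite 1 [← hflip]
  rw [← wsum_min (n := n) q]
  simp only [wsum, ← sum_sub_distrib, ← sum_add_distrib]
  refine sum_congr rfl fun w _ => ?_
  obtain ⟨hne, hne'⟩ := bval_ne w (i := 1) (j := 2) le_rfl (by omega) (by omega) (by omega)
    (by omega)
  have h1 : IsSnake (bval w) 2 ↔ bval w 1 < -bval w 2 ∧ bval w 2 < bval w 1 := by
    refine and_congr_right fun _ => ⟨fun h => (h 1 (by omega) le_rfl).1 odd_one,
      fun h i hi hi' => ?_⟩
    obtain rfl : i = 1 := by omega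
    exact ⟨fun _ => h, fun h' => absurd h' (by decide)⟩
  have h2 : IncFrom (bval w) 1 (n + 2) ↔ bval w 1 < bval w 2 ∧ IncFrom (bval w) 2 (n + 2) := by
    refine ⟨fun h => ⟨h 1 le_rfl (by omega), fun i hi hi' => h i (by omega) hi'⟩,
      fun h i hi hi' => ?_⟩
    rcases hi.eq_or_lt with rfl | hi
    · exact h.1
    · exact h.2 i hi hi'
  have h3 : IncFrom (bval (sComp w (signFlip (n + 1)))) 1 (n + 2) ↔
      -bval w 1 < bval w 2 ∧ IncFrom (bval w) 2 (n + 2) := by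
    constructor
    · intro h
      refine ⟨by simpa [bval_flip_position] using h 1 le_rfl (by omega), fun i hi hi' => ?_⟩
      have := h i (by omega) hi'
      rwa [bval_flip_position, bval_flip_position, if_neg (by omega), if_neg (by omega)] at this
    · intro h i hi hi'
      rw [bval_flip_position, bval_flip_position, if_neg (show i + 1 ≠ 1 by omega)]
      split_ifs with h1
      · rw [h1]; exact h.1
      · exact h.2 i (by omega) hi'
  simp only [h1, h2, h3]
  by_cases hI : IncFrom (bval w) 2 (n + 2)
  · rcases lt_or_gt_of_ne hne with h4 | h4 <;> rcases lt_or_gt_of_ne hne' with h5 | h5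
    · simp [hI, h4, h5, h4.not_gt, show ¬ -bval w 1 < bval w 2 by omega]
    · simp [hI, h4, h5.not_gt, h4.not_gt, show -bval w 1 < bval w 2 by omega]
    · simp [hI, h4, h5, h4.not_gt, show ¬ -bval w 1 < bval w 2 by omega]
    · simp [hI, h4, h5.not_gt, h4.not_gt, show -bval w 1 < bval w 2 by omega]
  · simp [hI]

lemma IsSnake.mono {a : ℕ → ℤ} {m m' : ℕ} (h : IsSnake a m) (hm : m' ≤ m) : IsSnake a m' :=
  ⟨h.1, fun i hi => h.2 i (by omega)⟩

lemma IncFrom.mono {a : ℕ → ℤ} {m m' n : ℕ} (h : IncFrom a m n) (hm : m ≤ m') :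
    IncFrom a m' n := fun i hi => h i (by omega)

lemma isSnake_succ {a : ℕ → ℤ} {m : ℕ} (hm : 1 ≤ m) : IsSnake a (m + 1) ↔
    IsSnake a m ∧ (Odd m → a (m + 1) < a m) ∧ (Even m → a m < a (m + 1)) := by
  refine ⟨fun h => ⟨h.mono (by omega), h.2 m (by omega) hm⟩, fun h => ⟨h.1.1, fun i hi hi' => ?_⟩⟩
  rcases (Nat.lt_succ_iff.1 hi).eq_or_lt with rfl | hi
  · exact h.2
  · exact h.1.2 i hi hi'

lemma incFrom_iff {a : ℕ → ℤ} {m n : ℕ} (hm : m < n) : IncFrom a m n ↔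
    a m < a (m + 1) ∧ IncFrom a (m + 1) n := by
  refine ⟨fun h => ⟨h m le_rfl hm, h.mono (by omega)⟩, fun h i hi hi' => ?_⟩
  rcases hi.eq_or_lt with rfl | hi
  · exact h.1
  · exact h.2 i hi hi'

lemma isSnake_and_incFrom_of_even {a : ℕ → ℤ} {e n : ℕ} (he : Even e) (h2 : 2 ≤ e) (hn : e < n) :
    IsSnake a e ∧ IncFrom a e n ↔ IsSnake a (e + 1) ∧ IncFrom a (e + 1) n := by
  rw [isSnake_succ (by omega), incFrom_iff hn]
  have : ¬ Odd e := Nat.not_odd_iff_even.2 he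
  tauto

lemma wsum_snake_inc_split {K : Type*} [Field K] (q : K) {n e : ℕ} (he : Even e) (h2 : 2 ≤ e)
    (hn : e + 2 ≤ n) :
    wsum q (fun w : BG n => IsSnake (bval w) (e + 1) ∧ IncFrom (bval w) (e + 2) n) =
      wsum q (fun w : BG n => IsSnake (bval w) e ∧ IncFrom (bval w) e n) +
        wsum q (fun w : BG n => IsSnake (bval w) (e + 2) ∧ IncFrom (bval w) (e + 2) n) := by
  classical
  simp only [wsum, ← sum_add_distrib]
  refine sum_congr rfl fun w _ => ?_
  have hA : IsSnake (bval w) e ∧ IncFrom (bval w) e n ↔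
      IsSnake (bval w) (e + 1) ∧ bval w (e + 1) < bval w (e + 1 + 1) ∧
        IncFrom (bval w) (e + 2) n := by
    rw [isSnake_and_incFrom_of_even he h2 (by omega), incFrom_iff (by omega)]
  have hB := isSnake_succ (a := bval w) (m := e + 1) (by omega)
  simp only [hA, show e + 2 = e + 1 + 1 from rfl, hB]
  have ho : Odd (e + 1) := he.add_one
  have ho' : ¬ Even (e + 1) := Nat.not_even_iff_odd.2 ho
  rcases lt_or_gt_of_ne (bval_ne w (i := e + 1) (j := e + 1 + 1) (by omega) (by omega) (by omega)
    (by omega) (by omega)).1 with h | h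
  · simp [ho, ho', h, h.not_gt]
  · simp [ho, ho', h, h.not_gt]

/-! ### Passage to the field of rational functions -/

lemma sum_qv_pow_ne_zero {α : Type*} {s : Finset α} (hs : s.Nonempty) (f : α → ℕ) :
    ∑ x ∈ s, qv ^ f x ≠ 0 := by
  have h : ∑ x ∈ s, qv ^ f x =
      algebraMap (Polynomial ℚ) Kq (∑ x ∈ s, (Polynomial.X : Polynomial ℚ) ^ f x) := by
    simp [qv, RatFunc.algebraMap_X]
  rw [h, Ne, map_eq_zero_iff _ (RatFunc.algebraMap_injective ℚ)]
  intro h0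
  have h1 := congrArg (Polynomial.eval 1) h0
  simp [Polynomial.eval_finsetSum] at h1
  exact hs.ne_empty h1

lemma DOne_qv_ne_zero (n : ℕ) : DOne n qv ≠ 0 := by
  refine sum_qv_pow_ne_zero ⟨(1, fun _ => false), ?_⟩ _
  have : negs ((1, fun _ => false) : BG n) = 0 := by
    rw [negs, card_eq_zero, filter_eq_empty_iff]
    intro i _
    simp only [bval]
    split_ifs
    · contradiction
    · omega
    · omega
  simp [DG, this]

lemma qFact_qv_ne_zero (k : ℕ) : qFact k qv ≠ 0 := by
  rw [← sum_pow_wordInv]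
  exact sum_qv_pow_ne_zero univ_nonempty _

lemma two_mul_DOne {K : Type*} [Field K] {n : ℕ} (hn : 1 ≤ n) (q : K) :
    2 * DOne n q = wsum q fun _ : BG n => True := by
  obtain ⟨n, rfl⟩ := Nat.exists_eq_add_of_le' hn
  rw [← two_mul_sum_DG q (fun _ => True) fun _ => Iff.rfl, filter_true, DOne]

lemma two_mul_SD {n : ℕ} (hn : 2 ≤ n) : 2 * SD n = wsum qv fun w : BG n => IsSnake (bval w) n := by
  classical
  obtain ⟨n, rfl⟩ := Nat.exists_eq_add_of_le' hn
  rw [← two_mul_sum_DG qv (fun w : BG (n + 2) => IsSnake (bval w) (n + 2)) isSnake_flip_value, SD]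
  congr 2
  exact filter_congr fun w _ => Iff.rfl

/-- The normalized generating function of the signed permutations which are a snake up to
position `e` and increasing from then on. -/
def snakeRun (n e : ℕ) : Kq :=
  wsum qv (fun w : BG n => IsSnake (bval w) e ∧ IncFrom (bval w) e n) / (2 * DOne n qv)

lemma snakeRun_two (n : ℕ) :
    snakeRun (n + 2) 2 = (qFact (n + 1) qv)⁻¹ - 2 * (qFact (n + 2) qv)⁻¹ + (DOne (n + 2) qv)⁻¹ := by
  have h1 := wsum_inc_mul qv (show n + 2 = 1 + (n + 1) by omega)
  have h2 := wsum_inc_mul qv (show n + 2 = 0 + (n + 2) by omega)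
  rw [← two_mul_DOne (by omega)] at h1 h2
  have hD := DOne_qv_ne_zero (n + 2)
  have hq := qFact_qv_ne_zero (n + 1)
  have hq' := qFact_qv_ne_zero (n + 2)
  rw [snakeRun, wsum_snake_two, eq_div_of_mul_eq hq h1, eq_div_of_mul_eq hq' h2]
  field_simp

lemma snakeRun_self {n : ℕ} (hn : 2 ≤ n) : snakeRun n n = SD n / DOne n qv := by
  have h : wsum qv (fun w : BG n => IsSnake (bval w) n ∧ IncFrom (bval w) n n) = 2 * SD n := by
    rw [two_mul_SD hn]
    exact wsum_congr qv fun w => and_iff_left fun i hi hi' => absurd hi' (not_lt.2 hi)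
  rw [snakeRun, h, mul_div_mul_left _ _ two_ne_zero]

lemma snakeRun_succ {e : ℕ} (he : Even e) (h2 : 2 ≤ e) :
    snakeRun (e + 1) e = SD (e + 1) / DOne (e + 1) qv := by
  rw [← snakeRun_self (by omega), snakeRun, snakeRun]
  congr 1
  exact wsum_congr qv fun w => isSnake_and_incFrom_of_even he h2 (by omega)

lemma snakeRun_add {n e k : ℕ} (he : Even e) (h2 : 2 ≤ e) (hn : e + 2 ≤ n) (hk : n = e + 1 + k) :
    snakeRun n e + snakeRun n (e + 2) = SD (e + 1) / DOne (e + 1) qv * (qFact k qv)⁻¹ := by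
  have h := wsum_snake_inc_mul qv hk (by omega)
  rw [← two_mul_DOne (by omega), ← two_mul_DOne (by omega), ← two_mul_SD (by omega),
    wsum_snake_inc_split qv he h2 hn] at h
  have hD := DOne_qv_ne_zero n
  have hD' := DOne_qv_ne_zero (e + 1)
  have hq := qFact_qv_ne_zero k
  rw [snakeRun, snakeRun]
  field_simp
  linear_combination h / 2

lemma sum_range_alternating {R : Type*} [CommRing R] (f : ℕ → R) (M : ℕ) :
    ∑ i ∈ range M, (-1) ^ i * (f i + f (i + 1)) = f 0 - (-1) ^ M * f M := by
  induction M with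
  | zero => simp
  | succ M ih => rw [sum_range_succ, ih]; ring

lemma sum_SD_even (M : ℕ) :
    ∑ i ∈ range M, (-1) ^ i * (SD (2 * i + 3) / DOne (2 * i + 3) qv *
        (qFact (2 * M + 2 - (2 * i + 3)) qv)⁻¹) =
      (qFact (2 * M + 1) qv)⁻¹ - 2 * (qFact (2 * M + 2) qv)⁻¹ + (DOne (2 * M + 2) qv)⁻¹ -
        (-1) ^ M * (SD (2 * M + 2) / DOne (2 * M + 2) qv) := by
  rw [← snakeRun_two, ← snakeRun_self (by omega),
    ← sum_range_alternating fun i => snakeRun (2 * M + 2) (2 * i + 2)]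
  refine sum_congr rfl fun i hi => ?_
  rw [mem_range] at hi
  rw [← snakeRun_add (n := 2 * M + 2) (e := 2 * i + 2) (by simp [parity_simps]) (by omega)
    (by omega) (by omega)]
  rfl

lemma sum_SD_odd (M : ℕ) :
    ∑ i ∈ range (M + 1), (-1) ^ i * (SD (2 * i + 3) / DOne (2 * i + 3) qv *
        (qFact (2 * M + 3 - (2 * i + 3)) qv)⁻¹) =
      (qFact (2 * M + 2) qv)⁻¹ - 2 * (qFact (2 * M + 3) qv)⁻¹ + (DOne (2 * M + 3) qv)⁻¹ := by
  have h : ∑ i ∈ range M, (-1) ^ i * (SD (2 * i + 3) / DOne (2 * i + 3) qv *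
        (qFact (2 * M + 3 - (2 * i + 3)) qv)⁻¹) =
      snakeRun (2 * M + 3) 2 - (-1) ^ M * snakeRun (2 * M + 3) (2 * M + 2) := by
    rw [← sum_range_alternating fun i => snakeRun (2 * M + 3) (2 * i + 2)]
    refine sum_congr rfl fun i hi => ?_
    rw [mem_range] at hi
    rw [← snakeRun_add (n := 2 * M + 3) (e := 2 * i + 2) (by simp [parity_simps]) (by omega)
      (by omega) (by omega)]
    rfl
  rw [sum_range_succ, h, ← snakeRun_two, snakeRun_succ (by simp [parity_simps]) (by omega)]
  simp [qFact]

/-! ### Generating functions -/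

lemma sum_range_odd {R : Type*} [AddCommMonoid R] (g : ℕ → R) (N : ℕ) :
    ∑ j ∈ range (N + 2), (if Odd j ∧ 3 ≤ j then g j else 0) =
      ∑ i ∈ range (N / 2), g (2 * i + 3) := by
  rw [← sum_filter]
  symm
  refine sum_bij (fun i _ => 2 * i + 3) (fun i hi => ?_) (fun i _ j _ h => ?_) (fun j hj => ?_)
    fun _ _ => rfl
  · rw [mem_range] at hi
    rw [mem_filter, mem_range]
    exact ⟨by omega, ⟨i + 1, by ring⟩, by omega⟩
  · omega
  · obtain ⟨h1, ⟨k, rfl⟩, h2⟩ := mem_filter.1 hj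
    rw [mem_range] at h1
    exact ⟨k - 1, mem_range.2 (by omega), by omega⟩

/-- The generating function of the D-snakes of odd length. -/
def oddSnakes : PowerSeries Kq :=
  PowerSeries.mk fun j => if Odd j ∧ 3 ≤ j then SD j / DOne j qv else 0

/-- The generating function of the D-snakes of positive even length. -/
def evenSnakes : PowerSeries Kq :=
  PowerSeries.mk fun j => if Even j ∧ 2 ≤ j then SD j / DOne j qv else 0

lemma coeff_oddSnakes_mul (g : ℕ → Kq) (N : ℕ) :
    coeff (N + 1) (oddSnakes * PowerSeries.mk g) =
      ∑ i ∈ range (N / 2), SD (2 * i + 3) / DOne (2 * i + 3) qv * g (N + 1 - (2 * i + 3)) := by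
  rw [coeff_mul, Nat.sum_antidiagonal_eq_sum_range_succ_mk, ← sum_range_odd
    (fun j => SD j / DOne j qv * g (N + 1 - j))]
  refine sum_congr rfl fun j _ => ?_
  simp [oddSnakes, ite_mul]

lemma DOne_zero {A : Type*} [CommRing A] (q : A) : DOne 0 q = 1 := by
  have : DG 0 = {(1, fun _ => false)} := by decide
  simp [DOne, this, invD]

lemma DOne_one {A : Type*} [CommRing A] (q : A) : DOne 1 q = 1 := by
  have : DG 1 = {(1, fun _ => false)} := by decide
  simp [DOne, this, invD, filter_singleton]

lemma neg_one_pow_mul_self {R : Type*} [CommRing R] (i : ℕ) : (-1 : R) ^ i * (-1) ^ i = 1 := by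
  rw [← mul_pow, neg_one_mul, neg_neg, one_pow]

lemma oddSnakes_mul_cosq :
    oddSnakes * cosq = 2 * sinq - PowerSeries.X * cosq - sinD := by
  ext N
  rcases N with _ | N
  · simp [oddSnakes, sinq, sinD, cosq, two_mul]
  rw [two_mul, map_sub, map_sub, map_add, coeff_succ_X_mul, cosq, coeff_oddSnakes_mul]
  simp only [sinq, sinD, coeff_mk]
  rcases Nat.even_or_odd' N with ⟨L, rfl | rfl⟩
  · rcases L with _ | M
    · simp [qFact, qInt, DOne_one]
    have h := sum_SD_odd M
    have h1 : ∑ i ∈ range (2 * (M + 1) / 2), SD (2 * i + 3) / DOne (2 * i + 3) qv *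
        (if Even (2 * (M + 1) + 1 - (2 * i + 3)) then
          (-1) ^ ((2 * (M + 1) + 1 - (2 * i + 3)) / 2) *
            (qFact (2 * (M + 1) + 1 - (2 * i + 3)) qv)⁻¹ else 0) =
        (-1) ^ M * ∑ i ∈ range (M + 1), (-1) ^ i * (SD (2 * i + 3) / DOne (2 * i + 3) qv *
          (qFact (2 * M + 3 - (2 * i + 3)) qv)⁻¹) := by
      rw [mul_sum, show 2 * (M + 1) / 2 = M + 1 by omega]
      refine sum_congr rfl fun i hi => ?_
      obtain ⟨j, rfl⟩ := Nat.exists_eq_add_of_le (Nat.lt_succ_iff.1 (mem_range.1 hi))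
      rw [show 2 * (i + j + 1) + 1 - (2 * i + 3) = 2 * j by omega,
        show 2 * (i + j) + 3 - (2 * i + 3) = 2 * j by omega, if_pos (even_two_mul j),
        Nat.mul_div_cancel_left j two_pos, pow_add, mul_assoc, ← mul_assoc _ (_ ^ i)]
      have := neg_one_pow_mul_self (R := Kq) i
      linear_combination (-(-1 : Kq) ^ j * (SD (2 * i + 3) / DOne (2 * i + 3) qv *
        (qFact (2 * j) qv)⁻¹)) * this
    rw [h1, h, if_pos (by simp [parity_simps]), if_pos (by simp [parity_simps]),
      if_pos (by simp [parity_simps]), show (2 * (M + 1) + 1) / 2 = M + 1 by omega,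
      show 2 * (M + 1) / 2 = M + 1 by omega]
    ring_nf
  · rw [sum_eq_zero fun i hi => ?_, if_neg (by simp [parity_simps]), if_neg (by simp [parity_simps]),
      if_neg (by simp [parity_simps])]
    · simp
    rw [mem_range] at hi
    rw [show 2 * L + 1 + 1 - (2 * i + 3) = 2 * (L - 1 - i) + 1 by omega,
      if_neg (by simp [parity_simps]), mul_zero]

lemma evenSnakes_eq :
    evenSnakes = oddSnakes * sinq + PowerSeries.X * sinq + 2 * cosq - 1 - cosD := by
  ext N
  rcases N with _ | N
  · simp [evenSnakes, oddSnakes, sinq, cosD, cosq, two_mul, qFact, DOne_zero]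
  rw [two_mul, map_sub, map_sub, map_add, map_add, map_add, coeff_succ_X_mul, sinq,
    coeff_oddSnakes_mul, coeff_one, if_neg N.succ_ne_zero]
  simp only [cosq, cosD, evenSnakes, coeff_mk]
  rcases Nat.even_or_odd' N with ⟨L, rfl | rfl⟩
  · rw [sum_eq_zero fun i hi => ?_, if_neg (by simp [parity_simps]), if_neg (by simp [parity_simps]),
      if_neg (by simp [parity_simps]), if_neg (by simp [parity_simps])]
    · simp
    rw [mem_range] at hi
    rw [show 2 * L + 1 - (2 * i + 3) = 2 * (L - 1 - i) by omega,
      if_neg (by simp [parity_simps]), mul_zero]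
  · have h := sum_SD_even L
    have h1 : ∑ i ∈ range ((2 * L + 1) / 2), SD (2 * i + 3) / DOne (2 * i + 3) qv *
        (if Odd (2 * L + 1 + 1 - (2 * i + 3)) then
          (-1) ^ ((2 * L + 1 + 1 - (2 * i + 3)) / 2) *
            (qFact (2 * L + 1 + 1 - (2 * i + 3)) qv)⁻¹ else 0) =
        -(-1) ^ L * ∑ i ∈ range L, (-1) ^ i * (SD (2 * i + 3) / DOne (2 * i + 3) qv *
          (qFact (2 * L + 2 - (2 * i + 3)) qv)⁻¹) := by
      rw [mul_sum, show (2 * L + 1) / 2 = L by omega]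
      refine sum_congr rfl fun i hi => ?_
      obtain ⟨j, rfl⟩ := Nat.exists_eq_add_of_lt (mem_range.1 hi)
      rw [show 2 * (i + j + 1) + 1 + 1 - (2 * i + 3) = 2 * j + 1 by omega,
        if_pos (odd_two_mul_add_one j),
        show (2 * j + 1) / 2 = j by omega, pow_succ, pow_add]
      have := neg_one_pow_mul_self (R := Kq) i
      linear_combination (-(-1 : Kq) ^ j * (SD (2 * i + 3) / DOne (2 * i + 3) qv *
        (qFact (2 * j + 1) qv)⁻¹)) * this
    rw [h1, h, if_pos (by simp [parity_simps]), if_pos (by simp [parity_simps]),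
      if_pos (by simp [parity_simps]), if_pos (by simp [parity_simps]),
      show (2 * L + 1) / 2 = L by omega, show (2 * L + 1 + 1) / 2 = L + 1 by omega, pow_succ]
    have := neg_one_pow_mul_self (R := Kq) L
    linear_combination (-SD (2 * L + 2) / DOne (2 * L + 2) qv) * this

theorem q_snakes_typeD :
    (PowerSeries.mk fun j => if Even j ∧ 2 ≤ j then SD j / DOne j qv else 0) * (-cosq)
      = -2 * cosq * (cosq - 1) + cosq * (cosD - 1) - 2 * sinq ^ 2 + sinq * sinD
    ∧
    (PowerSeries.mk fun j => if Odd j ∧ 3 ≤ j then SD j / DOne j qv else 0) * (-cosq)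
      = -2 * sinq + PowerSeries.X * cosq + sinD := by
  change evenSnakes * (-cosq) = _ ∧ oddSnakes * (-cosq) = _
  have h := oddSnakes_mul_cosq
  refine ⟨?_, by linear_combination -h⟩
  rw [evenSnakes_eq]
  linear_combination -sinq * h

end
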